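/- Let α ∈ Δ and σ, τ ∈ 𝓘 with σ < τ in the Bruhat order. Then: (i) if s_α ∘ σ > σ and s_α ∘ τ > τ, then s_α ∘ σ < s_α ∘ τ; (ii) if s_α ∘ σ < σ and s_α ∘ τ < τ, then s_α ∘ σ < s_α ∘ τ. -/

import Mathlib

open scoped RealInnerProductSpace
open Classical

noncomputable section

variable (V : Type) [NormedAddCommGroup V] [InnerProductSpace ℝ V]

/-- The reflection determined by a vector `α` (the identity map if `α = 0`),
as a linear endomorphism:  `x ↦ x - (2⟪x,α⟫/⟪α,α⟫) • α`. -/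
def reflMap (α : V) : V →ₗ[ℝ] V where
  toFun x := x - (2 * ⟪x, α⟫ / ⟪α, α⟫) • α
  map_add' x y := by
    simp only [inner_add_left]
    rw [show 2 * (⟪x, α⟫ + ⟪y, α⟫) / ⟪α, α⟫
        = 2 * ⟪x, α⟫ / ⟪α, α⟫ + 2 * ⟪y, α⟫ / ⟪α, α⟫ by ring, add_smul]
    abel
  map_smul' c x := by
    simp only [real_inner_smul_left, RingHom.id_apply, smul_sub]
    rw [show 2 * (c * ⟪x, α⟫) / ⟪α, α⟫ = c * (2 * ⟪x, α⟫ / ⟪α, α⟫) by ring,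
      mul_smul]

lemma reflMap_apply (α x : V) :
    reflMap V α x = x - (2 * ⟪x, α⟫ / ⟪α, α⟫) • α := rfl

lemma reflMap_involutive (α : V) : ∀ x, reflMap V α (reflMap V α x) = x := by
  intro x
  by_cases h : (⟪α, α⟫ : ℝ) = 0
  · have h0 : α = 0 := inner_self_eq_zero.mp h
    simp [reflMap_apply, h0]
  · rw [reflMap_apply, reflMap_apply, inner_sub_left, real_inner_smul_left,
      div_mul_cancel₀ _ h]
    rw [show ⟪x, α⟫ - 2 * ⟪x, α⟫ = -⟪x, α⟫ by ring]
    rw [show 2 * -⟪x, α⟫ / ⟪α, α⟫ = -(2 * ⟪x, α⟫ / ⟪α, α⟫) by ring, neg_smul]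
    abel

/-- The reflection determined by a vector `α`, as a linear automorphism of `V`. -/
def sref (α : V) : V ≃ₗ[ℝ] V :=
  { reflMap V α with
    invFun := reflMap V α
    left_inv := reflMap_involutive V α
    right_inv := reflMap_involutive V α }

lemma sref_apply (α x : V) :
    sref V α x = x - (2 * ⟪x, α⟫ / ⟪α, α⟫) • α := rfl

variable {V}

/-- The coroot `α^∨ = 2α/⟪α,α⟫` associated with a root `α`, under the identification of the
coweight space with `V` given by the inner product. -/
def coroot (α : V) : V := (2 / ⟪α, α⟫) • α

/-- The dimension of the `(-1)`-eigenspace of a linear automorphism. -/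
def lamEig (σ : V ≃ₗ[ℝ] V) : ℕ :=
  Module.finrank ℝ (Module.End.eigenspace (σ : V →ₗ[ℝ] V) (-1))

/-- The action `s_α ∘ σ` of a simple reflection on an involution: `s_α σ` if `s_α` and `σ`
commute, and `s_α σ s_α` otherwise. -/
def circAct (α : V) (σ : V ≃ₗ[ℝ] V) : V ≃ₗ[ℝ] V :=
  if sref V α * σ = σ * sref V α then sref V α * σ else sref V α * σ * sref V α

/-- A set of pairwise orthogonal vectors. -/
def OrthSet (S : Finset V) : Prop :=
  (↑S : Set V).Pairwise fun a b => ⟪a, b⟫ = 0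

/-- The product `σ_S` of the (commuting) reflections in the elements of an orthogonal set
`S`. -/
def sigmaOf (S : Finset V) : V ≃ₗ[ℝ] V :=
  (S.toList.map (sref V)).prod

variable (V)

/-- A finite crystallographic reduced root system in the Euclidean space `V`,
together with a fixed choice of simple roots. -/
structure RSD where
  /-- The set of roots. -/
  Φ : Finset V
  /-- The set of simple roots. -/
  Δ : Finset V
  nonzero : (0 : V) ∉ Φ
  span_top : Submodule.span ℝ (Φ : Set V) = ⊤
  reduced : ∀ α ∈ Φ, ∀ c : ℝ, c • α ∈ Φ → c = 1 ∨ c = -1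
  crystal : ∀ α ∈ Φ, ∀ β ∈ Φ, ∃ n : ℤ, (n : ℝ) = 2 * ⟪β, α⟫ / ⟪α, α⟫
  reflClosed : ∀ α ∈ Φ, ∀ β ∈ Φ, sref V α β ∈ Φ
  Δ_sub : Δ ⊆ Φ
  Δ_indep : LinearIndependent ℝ (fun x : (Δ : Set V) => (x : V))
  Δ_base : ∀ α ∈ Φ, (∃ c : V → ℕ, α = ∑ γ ∈ Δ, (c γ : ℝ) • γ) ∨
      (∃ c : V → ℕ, -α = ∑ γ ∈ Δ, (c γ : ℝ) • γ)

namespace RSD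

variable {V}
variable (D : RSD V)

/-- The set of positive roots. -/
def Pos : Set V :=
  {α | α ∈ D.Φ ∧ ∃ c : V → ℕ, α = ∑ γ ∈ D.Δ, (c γ : ℝ) • γ}

/-- The set of negative roots. -/
def Neg : Set V := {α | -α ∈ D.Pos}

/-- The Weyl group, as the subgroup of `GL(V)` generated by the simple reflections. -/
def W : Subgroup (V ≃ₗ[ℝ] V) := Subgroup.closure ((fun γ => sref V γ) '' ↑D.Δ)

/-- The length of `w`: the least number of simple reflections needed to write `w` as a
product of simple reflections. -/
def length (w : V ≃ₗ[ℝ] V) : ℕ :=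
  sInf {n | ∃ l : List V, l.length = n ∧ (∀ γ ∈ l, γ ∈ D.Δ) ∧ w = (l.map (sref V)).prod}

/-- The Bruhat order on the Weyl group: `u ≤ v` iff `v` is obtained from `u` by successively
multiplying by reflections, each time increasing the length. -/
def ble (u v : V ≃ₗ[ℝ] V) : Prop :=
  Relation.ReflTransGen
    (fun x y => (∃ β ∈ D.Φ, y = sref V β * x) ∧ D.length x < D.length y) u v

/-- The strict Bruhat order. -/
def blt (u v : V ≃ₗ[ℝ] V) : Prop := D.ble u v ∧ u ≠ v

/-- The dominance order: `y - x` is a nonnegative integer combination of simple roots. -/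
def dom (x y : V) : Prop := ∃ c : V → ℕ, y - x = ∑ γ ∈ D.Δ, (c γ : ℝ) • γ

/-- The dominance order on coweights: `y - x` is a nonnegative integer combination of simple
coroots. -/
def cdom (x y : V) : Prop := ∃ c : V → ℕ, y - x = ∑ γ ∈ D.Δ, (c γ : ℝ) • coroot γ

/-- The length `L(σ) = (ℓ(σ) + λ(σ))/2` of an involution `σ`, where `λ(σ)` is the dimension
of the `(-1)`-eigenspace of `σ`. -/
def Linv (σ : V ≃ₗ[ℝ] V) : ℚ :=
  ((D.length σ : ℚ) + (lamEig σ : ℚ)) / 2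

end RSD

/-- A finite irreducible crystallographic reduced root system, with a fixed choice of simple
roots and a marked simple root `αP` whose coefficient in the highest root `θ` equals `1`
(the cominuscule case). -/
structure MRSD extends RSD V where
  irred : ¬ ∃ A B : Set V, A.Nonempty ∧ B.Nonempty ∧ A ∪ B = ↑Φ ∧
      ∀ α ∈ A, ∀ β ∈ B, ⟪α, β⟫ = 0
  /-- The marked simple root. -/
  αP : V
  αP_mem : αP ∈ Δ
  /-- The highest root. -/
  θ : V
  θ_mem : θ ∈ Φ
  θ_high : ∀ α ∈ Φ, ∃ c : V → ℕ, θ - α = ∑ γ ∈ Δ, (c γ : ℝ) • γ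
  θ_coeff : ∃ c : V → ℕ, (θ = ∑ γ ∈ Δ, (c γ : ℝ) • γ) ∧ c αP = 1

namespace MRSD

variable {V}
variable (M : MRSD V)

/-- The set `Ψ` of positive roots in which the marked simple root `αP` has coefficient `1`. -/
def Psi : Set V :=
  {α | α ∈ M.Φ ∧ ∃ c : V → ℕ, (α = ∑ γ ∈ M.Δ, (c γ : ℝ) • γ) ∧ c M.αP = 1}

/-- The set of positive roots of the subsystem `Φ_P`, i.e. the positive roots in which the
marked simple root `αP` has coefficient `0`. -/
def PosP : Set V :=
  {α | α ∈ M.Φ ∧ ∃ c : V → ℕ, (α = ∑ γ ∈ M.Δ, (c γ : ℝ) • γ) ∧ c M.αP = 0}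

/-- The parabolic subgroup `W_P` generated by the simple reflections in `Δ ∖ {αP}`. -/
def WP : Subgroup (V ≃ₗ[ℝ] V) :=
  Subgroup.closure ((fun γ => sref V γ) '' ↑(M.Δ.erase M.αP))

/-- The inversion set `Φ⁺(v) = {α ∈ Φ⁺ : v(α) ∈ Φ⁻}`. -/
def InvSet (v : V ≃ₗ[ℝ] V) : Set V := {α | α ∈ M.Pos ∧ v α ∈ M.Neg}

/-- `v` belongs to `W^P`: it lies in `W` and has minimal length in its coset `v W_P`. -/
def IsMinRep (v : V ≃ₗ[ℝ] V) : Prop :=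
  v ∈ M.W ∧ ∀ u, u ∈ M.W → v⁻¹ * u ∈ M.WP → M.length v ≤ M.length u

/-- `μ` is the minimal length representative `[w]^P` of the coset `w W_P`. -/
def IsMinRepOf (μ w : V ≃ₗ[ℝ] V) : Prop :=
  (μ ∈ M.W ∧ w⁻¹ * μ ∈ M.WP) ∧
    ∀ u, u ∈ M.W → w⁻¹ * u ∈ M.WP → M.length μ ≤ M.length u

/-- The subset `Φ_S = {α ∈ Φ : σ_S(α) = -α}` determined by an orthogonal set of roots `S`. -/
def PhiSet (S : Finset V) : Set V := {α | α ∈ M.Φ ∧ sigmaOf S α = -α}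

/-- A root is long if its squared length is maximal among the roots. -/
def IsLong (α : V) : Prop := ∀ β ∈ M.Φ, ⟪β, β⟫ ≤ ⟪α, α⟫

/-- Admissible pair: `v ∈ W^P`, `S ⊆ Ψ` a set of pairwise orthogonal roots with
`v(S) ⊆ Φ⁻`. -/
def Admissible (v : V ≃ₗ[ℝ] V) (S : Finset V) : Prop :=
  M.IsMinRep v ∧ (↑S : Set V) ⊆ M.Psi ∧ OrthSet S ∧ ∀ β ∈ S, v β ∈ M.Neg

/-- The length `L(v,S) = (ℓ(σ_{v(S)}) + |S|)/2` of an admissible pair `(v,S)`. -/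
def pairL (v : V ≃ₗ[ℝ] V) (S : Finset V) : ℚ :=
  ((M.length (sigmaOf (S.image fun x => v x)) : ℚ) + (S.card : ℚ)) / 2

end MRSD

section Reflections

variable {V : Type} [NormedAddCommGroup V] [InnerProductSpace ℝ V]

lemma sref_mul_self (α : V) : sref V α * sref V α = 1 :=
  LinearEquiv.ext (reflMap_involutive V α)

lemma sref_inv (α : V) : (sref V α)⁻¹ = sref V α :=
  inv_eq_of_mul_eq_one_left (sref_mul_self α)

lemma sref_mul_cancel_left (α : V) (w : V ≃ₗ[ℝ] V) : sref V α * (sref V α * w) = w := by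
  rw [← mul_assoc, sref_mul_self, one_mul]

lemma sref_neg (α : V) : sref V (-α) = sref V α := by
  ext x
  simp [sref_apply, inner_neg_right, neg_div]

lemma sref_self {α : V} (h : α ≠ 0) : sref V α α = -α := by
  have h0 : (⟪α, α⟫ : ℝ) ≠ 0 := inner_self_ne_zero.mpr h
  rw [sref_apply, mul_div_assoc, div_self h0, mul_one, two_smul]
  abel

lemma inner_sref_sref (α x y : V) : ⟪sref V α x, sref V α y⟫ = ⟪x, y⟫ := by
  by_cases h : (⟪α, α⟫ : ℝ) = 0
  · have h0 : α = 0 := inner_self_eq_zero.mp h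
    simp [sref_apply, h0]
  · simp only [sref_apply, inner_sub_left, inner_sub_right, real_inner_smul_left,
      real_inner_smul_right, real_inner_comm α y]
    field_simp
    ring

/-- Conjugation of a reflection by an isometry. -/
lemma mul_sref_of_inner {w : V ≃ₗ[ℝ] V} (hw : ∀ x y, (⟪w x, w y⟫ : ℝ) = ⟪x, y⟫) (β : V) :
    w * sref V β = sref V (w β) * w := by
  ext x
  simp only [LinearEquiv.mul_apply, sref_apply, hw, map_sub, map_smul]

lemma circAct_injective {α : V} {σ τ : V ≃ₗ[ℝ] V} (h : circAct α σ = circAct α τ) : σ = τ := by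
  have key : ∀ {u v : V ≃ₗ[ℝ] V}, sref V α * u = u * sref V α →
      sref V α * u = sref V α * v * sref V α → sref V α * v = v * sref V α := by
    intro u v hu huv
    have hv : u = v * sref V α := by rwa [mul_assoc, mul_left_cancel_iff] at huv
    rw [hv, mul_assoc, sref_mul_self, mul_one, ← mul_assoc] at hu
    calc sref V α * v = sref V α * v * sref V α * sref V α := by
          rw [mul_assoc _ (sref V α) (sref V α), sref_mul_self, mul_one]
      _ = v * sref V α := by rw [hu]
  unfold circAct at h
  split_ifs at h with h1 h2 h2
  · exact mul_left_cancel h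
  · exact absurd (key h1 h) h2
  · exact absurd (key h2 h.symm) h1
  · exact mul_left_cancel (mul_right_cancel h)

end Reflections

namespace RSD

variable {V : Type} [NormedAddCommGroup V] [InnerProductSpace ℝ V] (D : RSD V)

lemma ne_zero_of_mem {α : V} (h : α ∈ D.Φ) : α ≠ 0 := fun h0 => D.nonzero (h0 ▸ h)

lemma neg_mem {α : V} (h : α ∈ D.Φ) : -α ∈ D.Φ :=
  sref_self (D.ne_zero_of_mem h) ▸ D.reflClosed α h α h

lemma simple_mem_pos {α : V} (h : α ∈ D.Δ) : α ∈ D.Pos :=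
  ⟨D.Δ_sub h, fun γ => if γ = α then 1 else 0, by simp [h]⟩

lemma pos_or_neg_pos {β : V} (h : β ∈ D.Φ) : β ∈ D.Pos ∨ -β ∈ D.Pos :=
  (D.Δ_base β h).imp (fun hc => ⟨h, hc⟩) (fun hc => ⟨D.neg_mem h, hc⟩)

lemma coeff_eq_zero {c : V → ℝ} (h : ∑ γ ∈ D.Δ, c γ • γ = 0) : ∀ γ ∈ D.Δ, c γ = 0 :=
  linearIndepOn_finset_iff.mp (show LinearIndepOn ℝ id (D.Δ : Set V) from D.Δ_indep) c h

lemma neg_notMem_pos {β : V} (h : β ∈ D.Pos) : -β ∉ D.Pos := by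
  rintro ⟨_, d, hd⟩
  obtain ⟨hΦ, c, hc⟩ := h
  have hsum : ∑ γ ∈ D.Δ, ((c γ : ℝ) + d γ) • γ = 0 := by
    simp only [add_smul, Finset.sum_add_distrib]
    rw [← hc, ← hd, add_neg_cancel]
  refine D.ne_zero_of_mem hΦ (hc.trans (Finset.sum_eq_zero fun γ hγ => ?_))
  have h0 := D.coeff_eq_zero hsum γ hγ
  have hcγ : (c γ : ℝ) = 0 := by
    linarith [Nat.cast_nonneg (α := ℝ) (c γ), Nat.cast_nonneg (α := ℝ) (d γ)]
  rw [hcγ, zero_smul]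

/-- A simple reflection permutes the positive roots other than its own simple root. -/
lemma sref_mem_pos {α β : V} (hα : α ∈ D.Δ) (hβ : β ∈ D.Pos) (hne : β ≠ α) :
    sref V α β ∈ D.Pos := by
  obtain ⟨hΦ, c, hc⟩ := hβ
  refine (D.pos_or_neg_pos (D.reflClosed α (D.Δ_sub hα) β hΦ)).resolve_right ?_
  rintro ⟨_, d, hd⟩
  set k : ℝ := 2 * ⟪β, α⟫ / ⟪α, α⟫ with hk
  have hsum : ∑ γ ∈ D.Δ, ((c γ : ℝ) + d γ - if γ = α then k else 0) • γ = 0 := by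
    simp only [add_smul, sub_smul, Finset.sum_add_distrib, Finset.sum_sub_distrib, ite_smul,
      zero_smul, Finset.sum_ite_eq', hα, if_true]
    rw [← hc, ← hd, sref_apply, ← hk]
    abel
  have h0 : ∀ γ ∈ D.Δ, γ ≠ α → (c γ : ℝ) • γ = 0 := by
    intro γ hγ hγα
    have h1 := D.coeff_eq_zero hsum γ hγ
    rw [if_neg hγα] at h1
    have h2 : (c γ : ℝ) = 0 := by
      linarith [Nat.cast_nonneg (α := ℝ) (c γ), Nat.cast_nonneg (α := ℝ) (d γ)]
    rw [h2, zero_smul]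
  have hβα : β = (c α : ℝ) • α := hc.trans (Finset.sum_eq_single_of_mem α hα h0)
  rcases D.reduced α (D.Δ_sub hα) (c α) (hβα ▸ hΦ) with h1 | h1
  · exact hne (by rw [hβα, h1, one_smul])
  · linarith [Nat.cast_nonneg (α := ℝ) (c α)]

lemma sref_mem_W {α : V} (h : α ∈ D.Δ) : sref V α ∈ D.W :=
  Subgroup.subset_closure ⟨α, h, rfl⟩

lemma inner_apply_apply {w : V ≃ₗ[ℝ] V} (hw : w ∈ D.W) : ∀ x y, (⟪w x, w y⟫ : ℝ) = ⟪x, y⟫ := by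
  induction hw using Subgroup.closure_induction with
  | mem w h =>
    obtain ⟨α, _, rfl⟩ := h
    exact inner_sref_sref α
  | one => exact fun _ _ => rfl
  | mul u v _ _ hu hv => exact fun x y => (hu _ _).trans (hv _ _)
  | inv u _ hu =>
    intro x y
    rw [← hu, ← LinearEquiv.mul_apply, ← LinearEquiv.mul_apply, mul_inv_cancel]
    rfl

/-- A word in the simple reflections, as an element of the Weyl group. -/
def IsWord (w : V ≃ₗ[ℝ] V) (l : List V) : Prop :=
  (∀ γ ∈ l, γ ∈ D.Δ) ∧ w = (l.map (sref V)).prod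

variable {D}

lemma IsWord.mem_W {w : V ≃ₗ[ℝ] V} {l : List V} (h : D.IsWord w l) : w ∈ D.W := by
  rw [h.2]
  refine Subgroup.list_prod_mem _ fun x hx => ?_
  obtain ⟨γ, hγ, rfl⟩ := List.mem_map.mp hx
  exact D.sref_mem_W (h.1 γ hγ)

lemma IsWord.length_le {w : V ≃ₗ[ℝ] V} {l : List V} (h : D.IsWord w l) :
    D.length w ≤ l.length :=
  Nat.sInf_le ⟨l, rfl, h⟩

lemma IsWord.cons {w : V ≃ₗ[ℝ] V} {l : List V} (h : D.IsWord w l) {α : V} (hα : α ∈ D.Δ) :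
    D.IsWord (sref V α * w) (α :: l) :=
  ⟨List.forall_mem_cons.mpr ⟨hα, h.1⟩, by rw [List.map_cons, List.prod_cons, ← h.2]⟩

lemma IsWord.mul {u v : V ≃ₗ[ℝ] V} {l m : List V} (hu : D.IsWord u l) (hv : D.IsWord v m) :
    D.IsWord (u * v) (l ++ m) :=
  ⟨fun γ hγ => (List.mem_append.mp hγ).elim (hu.1 γ) (hv.1 γ), by
    rw [List.map_append, List.prod_append, ← hu.2, ← hv.2]⟩

lemma IsWord.inv {w : V ≃ₗ[ℝ] V} {l : List V} (h : D.IsWord w l) : D.IsWord w⁻¹ l.reverse := by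
  refine ⟨fun γ hγ => h.1 γ (List.mem_reverse.mp hγ), ?_⟩
  rw [h.2, List.prod_inv_reverse, List.map_reverse, List.map_map]
  rw [show Inv.inv ∘ sref V = sref V from funext sref_inv]

variable (D)

lemma exists_isWord {w : V ≃ₗ[ℝ] V} (hw : w ∈ D.W) : ∃ l, D.IsWord w l := by
  induction hw using Subgroup.closure_induction with
  | mem w h =>
    obtain ⟨α, hα, rfl⟩ := h
    exact ⟨[α], fun γ hγ => List.mem_singleton.mp hγ ▸ hα, by simp⟩
  | one => exact ⟨[], by simp, by simp⟩
  | mul u v _ _ hu hv =>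
    obtain ⟨l, hl⟩ := hu
    obtain ⟨m, hm⟩ := hv
    exact ⟨_, hl.mul hm⟩
  | inv u _ hu =>
    obtain ⟨l, hl⟩ := hu
    exact ⟨_, hl.inv⟩

lemma exists_reduced_isWord {w : V ≃ₗ[ℝ] V} (hw : w ∈ D.W) :
    ∃ l, D.IsWord w l ∧ l.length = D.length w := by
  obtain ⟨l, hl⟩ := D.exists_isWord hw
  obtain ⟨m, hm, hm'⟩ := Nat.sInf_mem
    (s := {n | ∃ l : List V, l.length = n ∧ (∀ γ ∈ l, γ ∈ D.Δ) ∧ w = (l.map (sref V)).prod})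
    ⟨_, l, rfl, hl⟩
  exact ⟨m, hm', hm⟩

lemma mem_W_of_length_pos {w : V ≃ₗ[ℝ] V} (h : 0 < D.length w) : w ∈ D.W := by
  obtain ⟨_, l, _, hl⟩ := Nat.nonempty_of_pos_sInf h
  exact IsWord.mem_W hl

lemma apply_mem {w : V ≃ₗ[ℝ] V} (hw : w ∈ D.W) : ∀ β ∈ D.Φ, w β ∈ D.Φ := by
  obtain ⟨l, hl, rfl⟩ := D.exists_isWord hw
  clear hw
  induction l with
  | nil => exact fun _ h => h
  | cons a t ih =>
    intro β hβ
    rw [List.forall_mem_cons] at hl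
    rw [List.map_cons, List.prod_cons]
    exact D.reflClosed a (D.Δ_sub hl.1) _ (ih hl.2 β hβ)

lemma length_inv {w : V ≃ₗ[ℝ] V} (hw : w ∈ D.W) : D.length w⁻¹ = D.length w := by
  have key : ∀ {u : V ≃ₗ[ℝ] V}, u ∈ D.W → D.length u⁻¹ ≤ D.length u := by
    intro u hu
    obtain ⟨l, hl, hlen⟩ := D.exists_reduced_isWord hu
    simpa [hlen] using hl.inv.length_le
  exact (key hw).antisymm (by simpa using key (inv_mem hw))

lemma length_sref_mul_le {α : V} (hα : α ∈ D.Δ) {w : V ≃ₗ[ℝ] V} (hw : w ∈ D.W) :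
    D.length (sref V α * w) ≤ D.length w + 1 := by
  obtain ⟨l, hl, hlen⟩ := D.exists_reduced_isWord hw
  simpa [hlen] using (hl.cons hα).length_le

/-- The strong exchange condition. -/
lemma strong_exchange {w : V ≃ₗ[ℝ] V} {l : List V} (hl : D.IsWord w l) {β : V}
    (hβ : β ∈ D.Pos) (h : w⁻¹ β ∉ D.Pos) :
    ∃ m, D.IsWord (sref V β * w) m ∧ m.length + 1 = l.length := by
  induction l generalizing w β with
  | nil =>
    obtain ⟨_, rfl⟩ := hl
    exact absurd hβ (by simpa using h)
  | cons a t ih =>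
    obtain ⟨hmem, rfl⟩ := hl
    rw [List.forall_mem_cons] at hmem
    rw [List.map_cons, List.prod_cons] at h ⊢
    by_cases hβa : β = a
    · subst hβa
      exact ⟨t, ⟨hmem.2, sref_mul_cancel_left _ _⟩, rfl⟩
    · rw [mul_inv_rev, sref_inv, LinearEquiv.mul_apply] at h
      obtain ⟨m, hm, hlen⟩ := ih ⟨hmem.2, rfl⟩ (D.sref_mem_pos hmem.1 hβ hβa) h
      refine ⟨a :: m, ?_, by simp [hlen]⟩
      have h1 := hm.cons hmem.1
      rwa [← mul_assoc, mul_sref_of_inner (inner_sref_sref a), ← LinearEquiv.mul_apply,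
        sref_mul_self, mul_assoc] at h1

lemma length_sref_mul_lt {w : V ≃ₗ[ℝ] V} (hw : w ∈ D.W) {β : V} (hβ : β ∈ D.Pos)
    (h : w⁻¹ β ∉ D.Pos) : D.length (sref V β * w) < D.length w := by
  obtain ⟨l, hl, hlen⟩ := D.exists_reduced_isWord hw
  obtain ⟨m, hm, hmlen⟩ := D.strong_exchange hl hβ h
  have := hm.length_le
  omega

lemma lt_length_sref_mul {w : V ≃ₗ[ℝ] V} {β : V} (hw : sref V β * w ∈ D.W) (hβ : β ∈ D.Pos)
    (h : w⁻¹ β ∈ D.Pos) : D.length w < D.length (sref V β * w) := by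
  have h1 := D.length_sref_mul_lt hw hβ (by
    rw [mul_inv_rev, sref_inv, LinearEquiv.mul_apply, sref_self (D.ne_zero_of_mem hβ.1), map_neg]
    exact D.neg_notMem_pos h)
  rwa [sref_mul_cancel_left] at h1

lemma length_sref_mul_ne {α : V} (hα : α ∈ D.Δ) {w : V ≃ₗ[ℝ] V} (hw : w ∈ D.W) :
    D.length (sref V α * w) ≠ D.length w := by
  by_cases h : w⁻¹ α ∈ D.Pos
  · exact (D.lt_length_sref_mul (mul_mem (D.sref_mem_W hα) hw) (D.simple_mem_pos hα) h).ne'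
  · exact (D.length_sref_mul_lt hw (D.simple_mem_pos hα) h).ne

/-- A single step of the Bruhat order. -/
def BruhatStep (x y : V ≃ₗ[ℝ] V) : Prop :=
  (∃ β ∈ D.Φ, y = sref V β * x) ∧ D.length x < D.length y

variable {D}

lemma BruhatStep.mem_W {x y : V ≃ₗ[ℝ] V} (h : D.BruhatStep x y) : y ∈ D.W :=
  D.mem_W_of_length_pos (by have := h.2; omega)

lemma BruhatStep.ble {x y : V ≃ₗ[ℝ] V} (h : D.BruhatStep x y) : D.ble x y :=
  Relation.ReflTransGen.single h

lemma ble.trans {x y z : V ≃ₗ[ℝ] V} (h : D.ble x y) (h' : D.ble y z) : D.ble x z :=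
  Relation.ReflTransGen.trans h h'

lemma ble.induct {P : (V ≃ₗ[ℝ] V) → Prop} {x y : V ≃ₗ[ℝ] V} (h : D.ble x y) (hx : x ∈ D.W)
    (base : P x) (step : ∀ u v, u ∈ D.W → D.BruhatStep u v → P u → P v) : P y := by
  have h2 : y ∈ D.W ∧ P y := by
    induction h with
    | refl => exact ⟨hx, base⟩
    | tail _ huv ih => exact ⟨BruhatStep.mem_W huv, step _ _ ih.1 huv ih.2⟩
  exact h2.2

lemma blt.length_lt {x y : V ≃ₗ[ℝ] V} (h : D.blt x y) : D.length x < D.length y := by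
  obtain ⟨h, hne⟩ := h
  have h2 : y = x ∨ D.length x < D.length y := by
    clear hne
    induction h with
    | refl => exact Or.inl rfl
    | tail _ huv ih =>
      rcases ih with ih | ih
      · exact Or.inr (ih ▸ huv.2)
      · exact Or.inr (ih.trans huv.2)
  exact h2.resolve_left hne.symm

lemma BruhatStep.inv {x y : V ≃ₗ[ℝ] V} (hx : x ∈ D.W) (h : D.BruhatStep x y) :
    D.BruhatStep x⁻¹ y⁻¹ := by
  have hlt : D.length x⁻¹ < D.length y⁻¹ := by
    rw [D.length_inv hx, D.length_inv h.mem_W]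
    exact h.2
  obtain ⟨⟨β, hβ, rfl⟩, _⟩ := h
  refine ⟨⟨x⁻¹ β, D.apply_mem (inv_mem hx) β hβ, ?_⟩, hlt⟩
  rw [mul_inv_rev, sref_inv, mul_sref_of_inner (D.inner_apply_apply (inv_mem hx))]

lemma ble.inv {x y : V ≃ₗ[ℝ] V} (h : D.ble x y) (hx : x ∈ D.W) : D.ble x⁻¹ y⁻¹ :=
  h.induct (P := fun z => D.ble x⁻¹ z⁻¹) hx Relation.ReflTransGen.refl
    fun _ _ hu huv ih => ih.trans (huv.inv hu).ble

lemma BruhatStep.sref_mul {x y : V ≃ₗ[ℝ] V} (hx : x ∈ D.W) (h : D.BruhatStep x y) {α : V}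
    (hα : α ∈ D.Δ) : y = sref V α * x ∨ D.BruhatStep (sref V α * x) (sref V α * y) := by
  have hyW := h.mem_W
  obtain ⟨⟨β, hβ, rfl⟩, hlt⟩ := h
  wlog hpos : β ∈ D.Pos generalizing β
  · have h1 := this (-β) (D.neg_mem hβ)
    rw [sref_neg] at h1
    exact h1 hyW hlt ((D.pos_or_neg_pos hβ).resolve_left hpos)
  by_cases hβα : β = α
  · exact Or.inl (by rw [hβα])
  right
  have heq : sref V α * (sref V β * x) = sref V (sref V α β) * (sref V α * x) := by
    rw [← mul_assoc, mul_sref_of_inner (inner_sref_sref α), mul_assoc]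
  refine ⟨⟨sref V α β, D.reflClosed α (D.Δ_sub hα) β hβ, heq⟩, ?_⟩
  have hxβ : x⁻¹ β ∈ D.Pos := by
    by_contra hn
    exact absurd (D.length_sref_mul_lt hx hpos hn) hlt.not_gt
  rw [heq]
  refine D.lt_length_sref_mul (heq ▸ mul_mem (D.sref_mem_W hα) hyW)
    (D.sref_mem_pos hα hpos hβα) ?_
  rwa [mul_inv_rev, sref_inv, ← LinearEquiv.mul_apply, mul_assoc, sref_mul_self, mul_one]

variable (D)

/-- The longer of `w` and `s_α w`. -/
def up (α : V) (w : V ≃ₗ[ℝ] V) : V ≃ₗ[ℝ] V :=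
  if D.length w < D.length (sref V α * w) then sref V α * w else w

/-- The shorter of `w` and `s_α w`. -/
def down (α : V) (w : V ≃ₗ[ℝ] V) : V ≃ₗ[ℝ] V :=
  if D.length w < D.length (sref V α * w) then w else sref V α * w

lemma up_mem_W {α : V} (hα : α ∈ D.Δ) {w : V ≃ₗ[ℝ] V} (hw : w ∈ D.W) : D.up α w ∈ D.W := by
  unfold up
  split_ifs
  exacts [mul_mem (D.sref_mem_W hα) hw, hw]

lemma down_mem_W {α : V} (hα : α ∈ D.Δ) {w : V ≃ₗ[ℝ] V} (hw : w ∈ D.W) : D.down α w ∈ D.W := by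
  unfold down
  split_ifs
  exacts [hw, mul_mem (D.sref_mem_W hα) hw]

lemma bruhatStep_sref_mul {α : V} (hα : α ∈ D.Δ) {w : V ≃ₗ[ℝ] V}
    (h : D.length w < D.length (sref V α * w)) : D.BruhatStep w (sref V α * w) :=
  ⟨⟨α, D.Δ_sub hα, rfl⟩, h⟩

lemma bruhatStep_of_not_lt {α : V} (hα : α ∈ D.Δ) {w : V ≃ₗ[ℝ] V} (hw : w ∈ D.W)
    (h : ¬ D.length w < D.length (sref V α * w)) : D.BruhatStep (sref V α * w) w :=
  ⟨⟨α, D.Δ_sub hα, (sref_mul_cancel_left _ _).symm⟩,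
    lt_of_le_of_ne (not_lt.mp h) (D.length_sref_mul_ne hα hw)⟩

lemma ble_up {α : V} (hα : α ∈ D.Δ) (w : V ≃ₗ[ℝ] V) : D.ble w (D.up α w) := by
  unfold up
  split_ifs with h
  exacts [(D.bruhatStep_sref_mul hα h).ble, Relation.ReflTransGen.refl]

lemma sref_mul_ble_up {α : V} (hα : α ∈ D.Δ) {w : V ≃ₗ[ℝ] V} (hw : w ∈ D.W) :
    D.ble (sref V α * w) (D.up α w) := by
  unfold up
  split_ifs with h
  exacts [Relation.ReflTransGen.refl, (D.bruhatStep_of_not_lt hα hw h).ble]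

lemma down_ble {α : V} (hα : α ∈ D.Δ) {w : V ≃ₗ[ℝ] V} (hw : w ∈ D.W) :
    D.ble (D.down α w) w := by
  unfold down
  split_ifs with h
  exacts [Relation.ReflTransGen.refl, (D.bruhatStep_of_not_lt hα hw h).ble]

lemma down_ble_sref_mul {α : V} (hα : α ∈ D.Δ) (w : V ≃ₗ[ℝ] V) :
    D.ble (D.down α w) (sref V α * w) := by
  unfold down
  split_ifs with h
  exacts [(D.bruhatStep_sref_mul hα h).ble, Relation.ReflTransGen.refl]

lemma up_sref_mul {α : V} (hα : α ∈ D.Δ) {w : V ≃ₗ[ℝ] V} (hw : w ∈ D.W) :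
    D.up α (sref V α * w) = D.up α w := by
  have := D.length_sref_mul_ne hα hw
  unfold up
  rw [sref_mul_cancel_left]
  split_ifs
  all_goals first | rfl | omega

lemma down_sref_mul {α : V} (hα : α ∈ D.Δ) {w : V ≃ₗ[ℝ] V} (hw : w ∈ D.W) :
    D.down α (sref V α * w) = D.down α w := by
  have := D.length_sref_mul_ne hα hw
  unfold down
  rw [sref_mul_cancel_left]
  split_ifs
  all_goals first | rfl | omega

variable {D}

lemma ble.up {α : V} (hα : α ∈ D.Δ) {x y : V ≃ₗ[ℝ] V} (h : D.ble x y) (hx : x ∈ D.W) :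
    D.ble (D.up α x) (D.up α y) := by
  refine h.induct (P := fun z => D.ble (D.up α x) (D.up α z)) hx Relation.ReflTransGen.refl ?_
  intro u v hu huv ih
  refine ih.trans ?_
  rcases huv.sref_mul hu hα with rfl | hs
  · rw [D.up_sref_mul hα hu]
    exact Relation.ReflTransGen.refl
  · conv => enter [2]; unfold RSD.up
    split_ifs
    · exact hs.ble.trans (D.sref_mul_ble_up hα huv.mem_W)
    · exact huv.ble.trans (D.ble_up hα v)

lemma ble.down {α : V} (hα : α ∈ D.Δ) {x y : V ≃ₗ[ℝ] V} (h : D.ble x y) (hx : x ∈ D.W) :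
    D.ble (D.down α x) (D.down α y) := by
  refine h.induct (P := fun z => D.ble (D.down α x) (D.down α z)) hx
    Relation.ReflTransGen.refl ?_
  intro u v hu huv ih
  refine ih.trans ?_
  rcases huv.sref_mul hu hα with rfl | hs
  · rw [D.down_sref_mul hα hu]
    exact Relation.ReflTransGen.refl
  · conv => enter [3]; unfold RSD.down
    split_ifs
    · exact (D.down_ble hα hu).trans huv.ble
    · exact (D.down_ble_sref_mul hα u).trans hs.ble

variable (D)

/-- For an involution `σ`, the inverse elements `s_α σ` and `σ s_α` have the same length. -/
lemma inv_sref_mul_and_length {α : V} (hα : α ∈ D.Δ) {σ : V ≃ₗ[ℝ] V} (hW : σ ∈ D.W) (hσ : σ * σ = 1) :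
    (sref V α * σ)⁻¹ = σ * sref V α ∧ D.length (σ * sref V α) = D.length (sref V α * σ) := by
  have h1 : (sref V α * σ)⁻¹ = σ * sref V α := by
    rw [mul_inv_rev, sref_inv, inv_eq_of_mul_eq_one_left hσ]
  exact ⟨h1, h1 ▸ D.length_inv (mul_mem (D.sref_mem_W hα) hW)⟩

lemma circAct_eq_up {α : V} (hα : α ∈ D.Δ) {σ : V ≃ₗ[ℝ] V} (hW : σ ∈ D.W) (hσ : σ * σ = 1)
    (h : D.blt σ (circAct α σ)) : circAct α σ = D.up α (D.up α σ)⁻¹ := by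
  have hlt := h.length_lt
  obtain ⟨hinv, hlen⟩ := D.inv_sref_mul_and_length hα hW hσ
  unfold circAct at hlt ⊢
  split_ifs at hlt ⊢ with hc
  · rw [up, up, if_pos hlt, hinv, ← hc, sref_mul_cancel_left, if_neg hlt.not_gt]
  · rw [mul_assoc] at hlt ⊢
    have hW' : σ * sref V α ∈ D.W := mul_mem hW (D.sref_mem_W hα)
    have h1 := D.length_sref_mul_le hα hW
    have h2 := D.length_sref_mul_le hα hW'
    have h3 := D.length_sref_mul_ne hα hW
    have h4 := D.length_sref_mul_ne hα hW'
    have hu : D.up α σ = sref V α * σ := if_pos (by omega)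
    rw [hu, hinv, up, if_pos (by omega)]

lemma circAct_eq_down {α : V} (hα : α ∈ D.Δ) {σ : V ≃ₗ[ℝ] V} (hW : σ ∈ D.W) (hσ : σ * σ = 1)
    (h : D.blt (circAct α σ) σ) : circAct α σ = D.down α (D.down α σ)⁻¹ := by
  have hlt := h.length_lt
  obtain ⟨hinv, hlen⟩ := D.inv_sref_mul_and_length hα hW hσ
  unfold circAct at hlt ⊢
  split_ifs at hlt ⊢ with hc
  · rw [down, down, if_neg hlt.not_gt, hinv, ← hc, sref_mul_cancel_left, if_pos hlt]
  · rw [mul_assoc] at hlt ⊢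
    have hW' : σ * sref V α ∈ D.W := mul_mem hW (D.sref_mem_W hα)
    have hs := sref_mul_cancel_left α σ
    have hs' := sref_mul_cancel_left α (σ * sref V α)
    have h1 := D.length_sref_mul_le hα (mul_mem (D.sref_mem_W hα) hW)
    have h2 := D.length_sref_mul_le hα (mul_mem (D.sref_mem_W hα) hW')
    have h3 := D.length_sref_mul_ne hα hW
    have h4 := D.length_sref_mul_ne hα hW'
    rw [hs] at h1
    rw [hs'] at h2
    have hd : D.down α σ = sref V α * σ := if_neg (by omega)
    rw [hd, hinv, down, if_neg (by omega)]

end RSD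

/-- Let `α ∈ Δ` and `σ < τ` involutions.  (i) If `s_α ∘ σ > σ` and
`s_α ∘ τ > τ` then `s_α ∘ σ < s_α ∘ τ`; (ii) if `s_α ∘ σ < σ` and `s_α ∘ τ < τ` then
`s_α ∘ σ < s_α ∘ τ`. -/
theorem statement8 {V : Type} [NormedAddCommGroup V] [InnerProductSpace ℝ V]
    [FiniteDimensional ℝ V]
    (D : RSD V) (α : V) (hα : α ∈ D.Δ)
    (σ τ : V ≃ₗ[ℝ] V) (hσW : σ ∈ D.W) (hσ : σ * σ = 1)
    (hτW : τ ∈ D.W) (hτ : τ * τ = 1) (hlt : D.blt σ τ) :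
    (D.blt σ (circAct α σ) → D.blt τ (circAct α τ) →
      D.blt (circAct α σ) (circAct α τ)) ∧
    (D.blt (circAct α σ) σ → D.blt (circAct α τ) τ →
      D.blt (circAct α σ) (circAct α τ)) := by
  have hne : circAct α σ ≠ circAct α τ := fun h => hlt.2 (circAct_injective h)
  refine ⟨fun h1 h2 => ⟨?_, hne⟩, fun h1 h2 => ⟨?_, hne⟩⟩
  · rw [D.circAct_eq_up hα hσW hσ h1, D.circAct_eq_up hα hτW hτ h2]
    have hW := D.up_mem_W hα hσW
    exact ((hlt.1.up hα hσW).inv hW).up hα (inv_mem hW)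
  · rw [D.circAct_eq_down hα hσW hσ h1, D.circAct_eq_down hα hτW hτ h2]
    have hW := D.down_mem_W hα hσW
    exact ((hlt.1.down hα hσW).inv hW).down hα (inv_mem hW)
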